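/- For every type-B composition α = (α₁,…,α_r) of n, the length of Tam_B(α) — the maximum m for which there exists a chain x₀ < x₁ < ⋯ < x_m in H_α(231) under inclusion of inversion sets — equals n² − Σ_{i=1}^r α_i(α_i−1)/2 − (α₁+1)α₁/2 if α is join, and equals n² − Σ_{i=1}^r α_i(α_i−1)/2 if α is split. -/

import Mathlib

namespace TypeB

/-- A sign-symmetric permutation of degree `n`: a bijection of `ℤ` with
`π(-i) = -π(i)` which fixes every integer of absolute value `> n`.
It restricts to a sign-symmetric permutation of `±[n]`. -/
structure SignedPerm (n : ℕ) where
  perm : Equiv.Perm ℤ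
  sign_symm : ∀ i : ℤ, perm (-i) = - perm i
  outside : ∀ i : ℤ, (n : ℤ) < |i| → perm i = i

/-- Symbols for type-B inversions: `neg i` is `[i]`, `pair i j` (with `i < j`)
is `(i,j)`, and `mixed i j` (with `i < j`) is `(−j, i)`. -/
inductive BInv (n : ℕ) : Type where
  | neg : ℕ → BInv n
  | pair : ℕ → ℕ → BInv n
  | mixed : ℕ → ℕ → BInv n
deriving DecidableEq

/-- `i⁺`: `i+1` if `i ≠ -1`, and `1` for `i = -1`. -/
def iplus (i : ℤ) : ℤ := if i = -1 then 1 else i + 1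

/-- The inversion set of a sign-symmetric permutation. -/
def Inv {n : ℕ} (π : SignedPerm n) : Set (BInv n) := fun t =>
  match t with
  | .neg i => 1 ≤ i ∧ i ≤ n ∧ π.perm (i : ℤ) < 0
  | .pair i j => 1 ≤ i ∧ i < j ∧ j ≤ n ∧ π.perm (j : ℤ) < π.perm (i : ℤ)
  | .mixed i j => 1 ≤ i ∧ i < j ∧ j ≤ n ∧ π.perm (i : ℤ) + π.perm (j : ℤ) < 0

/-- The cover-inversion set of a sign-symmetric permutation. -/
def Cov {n : ℕ} (π : SignedPerm n) : Set (BInv n) := fun t =>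
  match t with
  | .neg i => 1 ≤ i ∧ i ≤ n ∧ π.perm (i : ℤ) = -1
  | .pair i j => 1 ≤ i ∧ i < j ∧ j ≤ n ∧ π.perm (i : ℤ) = iplus (π.perm (j : ℤ))
  | .mixed i j => 1 ≤ i ∧ i < j ∧ j ≤ n ∧ π.perm (-(j : ℤ)) = iplus (π.perm (i : ℤ))

/-- The symbol `(−j, i)` in canonical form (it equals `(−i, j)`). -/
def mixedInv {n : ℕ} (i j : ℕ) : BInv n := .mixed (min i j) (max i j)

/-- A type-B composition of `n`: positive parts summing to `n`,
together with a split/join label. -/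
structure BComp (n : ℕ) where
  parts : List ℕ
  pos : ∀ a ∈ parts, 0 < a
  sum_eq : parts.sum = n
  isJoin : Bool

/-- The partial sum `p_i = α₁ + ⋯ + α_i`. -/
def pSum {n : ℕ} (α : BComp n) (i : ℕ) : ℕ := (α.parts.take i).sum

/-- The α-region of `a ∈ [n]`: the unique `i` with `p_{i-1} < a ≤ p_i`. -/
def region {n : ℕ} (α : BComp n) (a : ℕ) : ℕ :=
  ((Finset.range α.parts.length).filter (fun j => pSum α j < a)).card

/-- The first part `α₁` of a type-B composition. -/
def alpha1 {n : ℕ} (α : BComp n) : ℕ := α.parts.headI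

/-- Index of the block of `Part(α)` containing `x ∈ ±[n]`; two elements lie in
a common block of `Part(α)` iff their indices agree. -/
def blockIdx {n : ℕ} (α : BComp n) (x : ℤ) : ℤ :=
  if 0 < x then
    (if α.isJoin = true ∧ region α x.toNat = 1 then 0 else (region α x.toNat : ℤ))
  else
    (if α.isJoin = true ∧ region α (-x).toNat = 1 then 0 else -(region α (-x).toNat : ℤ))

/-- Membership in `±[n]`. -/
def inPM (n : ℕ) (x : ℤ) : Prop := x ≠ 0 ∧ -(n : ℤ) ≤ x ∧ x ≤ (n : ℤ)

/-- `π ∈ H_α`: `π` is increasing on every block of `Part(α)`. -/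
def memH {n : ℕ} (α : BComp n) (π : SignedPerm n) : Prop :=
  ∀ a b : ℤ, inPM n a → inPM n b → a < b → blockIdx α a = blockIdx α b →
    π.perm a < π.perm b

/-- Common part of the type-B `(α,231)`- and `(α,312)`-patterns: indices
`i < j < k` in `±[n]`, in pairwise distinct blocks of `Part(α)`, with `j > 0`
and `π(i) = π(k)⁺`. -/
def patternCore {n : ℕ} (α : BComp n) (π : SignedPerm n) (i j k : ℤ) : Prop :=
  inPM n i ∧ inPM n j ∧ inPM n k ∧ i < j ∧ j < k ∧ 0 < j ∧
  blockIdx α i ≠ blockIdx α j ∧ blockIdx α j ≠ blockIdx α k ∧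
  blockIdx α i ≠ blockIdx α k ∧ π.perm i = iplus (π.perm k)

/-- `π` has a type-B `(α,231)`-split (resp. -join) pattern, according to the
label of `α`. -/
def has231 {n : ℕ} (α : BComp n) (π : SignedPerm n) : Prop :=
  ∃ i j k : ℤ, patternCore α π i j k ∧
    (if α.isJoin = true then
       (((alpha1 α : ℤ) < j → π.perm i < π.perm j) ∧
        (j ≤ (alpha1 α : ℤ) → π.perm j < π.perm k))
     else π.perm i < π.perm j)

/-- `π` has a type-B `(α,312)`-split (resp. -join) pattern, according to the
label of `α`. -/
def has312 {n : ℕ} (α : BComp n) (π : SignedPerm n) : Prop :=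
  ∃ i j k : ℤ, patternCore α π i j k ∧
    (if α.isJoin = true then
       (((alpha1 α : ℤ) < j → π.perm j < π.perm k) ∧
        (j ≤ (alpha1 α : ℤ) → π.perm i < π.perm j))
     else π.perm j < π.perm k)

/-- `π ∈ H_α(231)`. -/
def mem231 {n : ℕ} (α : BComp n) (π : SignedPerm n) : Prop := memH α π ∧ ¬ has231 α π

/-- `π ∈ H_α(312)`. -/
def mem312 {n : ℕ} (α : BComp n) (π : SignedPerm n) : Prop := memH α π ∧ ¬ has312 α π

/-- The set `H_α`. -/
def Hset {n : ℕ} (α : BComp n) : Set (SignedPerm n) := {π | memH α π}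

/-- The carrier of `Tam_B(α)`, namely `H_α(231)`. -/
def Tset {n : ℕ} (α : BComp n) : Set (SignedPerm n) := {π | mem231 α π}

/-- The weak order: inclusion of inversion sets. -/
def wle {n : ℕ} (π σ : SignedPerm n) : Prop := Inv π ⊆ Inv σ

/-- `m` is the greatest lower bound of `x` and `y` within `P`, w.r.t. the weak order. -/
def isMeetIn {n : ℕ} (P : Set (SignedPerm n)) (x y m : SignedPerm n) : Prop :=
  m ∈ P ∧ wle m x ∧ wle m y ∧ ∀ z ∈ P, wle z x → wle z y → wle z m

/-- `u` is the least upper bound of `x` and `y` within `P`, w.r.t. the weak order. -/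
def isJoinIn {n : ℕ} (P : Set (SignedPerm n)) (x y u : SignedPerm n) : Prop :=
  u ∈ P ∧ wle x u ∧ wle y u ∧ ∀ z ∈ P, wle x z → wle y z → wle u z

/-- `d = Π↓(π)`: `d` is the greatest element of `{σ ∈ H_α(231) : Inv σ ⊆ Inv π}`. -/
def isProjDown {n : ℕ} (α : BComp n) (π d : SignedPerm n) : Prop :=
  mem231 α d ∧ wle d π ∧ ∀ σ, mem231 α σ → wle σ π → wle σ d

/-- `d = Π†(π)`: `d` is the greatest element of `{σ ∈ H_α(312) : Inv σ ⊆ Inv π}`. -/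
def isProjDagger {n : ℕ} (α : BComp n) (π d : SignedPerm n) : Prop :=
  mem312 α d ∧ wle d π ∧ ∀ σ, mem312 α σ → wle σ π → wle σ d

/-- The value `ω_{o;α}(a)` for `a ∈ [n]`. -/
def omegaPos {n : ℕ} (α : BComp n) (a : ℕ) : ℤ :=
  if α.isJoin = true ∧ region α a = 1 then (a : ℤ)
  else -(((pSum α (region α a) : ℤ) + (pSum α (region α a - 1) : ℤ) + 1) - (a : ℤ))

/-- The longest element `ω_{o;α}` of `H_α`, as a function on `ℤ`. -/
def omegaFun {n : ℕ} (α : BComp n) (x : ℤ) : ℤ :=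
  if 0 < x ∧ x ≤ (n : ℤ) then omegaPos α x.toNat
  else if 0 < -x ∧ -x ≤ (n : ℤ) then -(omegaPos α (-x).toNat)
  else x

/-- The set of `m` such that there is a strict chain `x₀ < x₁ < ⋯ < x_m` in `P`. -/
def chainLengths {n : ℕ} (P : Set (SignedPerm n)) : Set ℕ :=
  {m | ∃ f : Fin (m + 1) → SignedPerm n, (∀ i, f i ∈ P) ∧
        ∀ i j : Fin (m + 1), i < j → Inv (f i) ⊂ Inv (f j)}

/-- `x` is join-irreducible in `Tam_B(α)`. -/
def joinIrred {n : ℕ} (α : BComp n) (x : SignedPerm n) : Prop :=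
  x ∈ Tset α ∧ ¬ (∀ y ∈ Tset α, wle x y) ∧
  ∀ y z, y ∈ Tset α → z ∈ Tset α → isJoinIn (Tset α) y z x → x = y ∨ x = z

/-- `x` is meet-irreducible in `Tam_B(α)`. -/
def meetIrred {n : ℕ} (α : BComp n) (x : SignedPerm n) : Prop :=
  x ∈ Tset α ∧ ¬ (∀ y ∈ Tset α, wle y x) ∧
  ∀ y z, y ∈ Tset α → z ∈ Tset α → isMeetIn (Tset α) y z x → x = y ∨ x = z

/-- `x` is left modular in the lattice on `P`: `(r ∨ x) ∧ q = r ∨ (x ∧ q)`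
for all `r ≤ q` in `P`. -/
def leftModular {n : ℕ} (P : Set (SignedPerm n)) (x : SignedPerm n) : Prop :=
  ∀ r q, r ∈ P → q ∈ P → wle r q →
    ∀ u v w1 w2, isJoinIn P r x u → isMeetIn P u q v →
      isMeetIn P x q w1 → isJoinIn P r w1 w2 → v = w2

/-- The simple generator `s_i` as a function on `ℤ`: `s₀` exchanges `1` and `-1`,
and for `i ≥ 1`, `s_i` exchanges `i` with `i+1` and `-i` with `-(i+1)`. -/
def sfun (i : ℕ) (x : ℤ) : ℤ :=
  if i = 0 then (if x = 1 then -1 else if x = -1 then 1 else x)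
  else if x = (i : ℤ) then (i : ℤ) + 1
  else if x = (i : ℤ) + 1 then (i : ℤ)
  else if x = -(i : ℤ) then -(i : ℤ) - 1
  else if x = -(i : ℤ) - 1 then -(i : ℤ)
  else x

/-- `i` is one of the partial sums `p₁, …, p_{r−1}` of `α`. -/
def isPSum {n : ℕ} (α : BComp n) (i : ℕ) : Prop :=
  ∃ j : ℕ, 1 ≤ j ∧ j < α.parts.length ∧ pSum α j = i

/-- `n² − Σᵢ α_i(α_i−1)/2`, minus additionally `(α₁+1)α₁/2` when `α` is join. -/
def lengthFormula {n : ℕ} (α : BComp n) : ℕ :=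
  n ^ 2 - (α.parts.map (fun a => a * (a - 1) / 2)).sum -
    (if α.isJoin = true then (alpha1 α + 1) * alpha1 α / 2 else 0)

theorem sfun_lt_iff {v : ℕ} (hv : 1 ≤ v) {u w : ℤ}
    (h1 : ¬(u = v ∧ w = v + 1)) (h2 : ¬(u = v + 1 ∧ w = v))
    (h3 : ¬(u = -v ∧ w = -v - 1)) (h4 : ¬(u = -v - 1 ∧ w = -v)) :
    sfun v u < sfun v w ↔ u < w := by
  have hv0 : v ≠ 0 := by omega
  simp only [sfun, hv0, if_false]
  split_ifs <;> omega

theorem sfun_neg (v : ℕ) (u : ℤ) : sfun v (-u) = -sfun v u := by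
  simp only [sfun]
  split_ifs <;> omega

theorem sfun_neg_iff {v : ℕ} (hv : 1 ≤ v) (u : ℤ) : sfun v u < 0 ↔ u < 0 := by
  have hv0 : v ≠ 0 := by omega
  simp only [sfun, hv0, if_false]
  split_ifs <;> omega

theorem sfun_involutive (v : ℕ) : Function.Involutive (sfun v) := by
  intro u
  generalize h : sfun v u = w
  simp only [sfun] at h ⊢
  split_ifs at h ⊢ <;> omega

theorem sfun_zero_of_ne {u : ℤ} (h1 : u ≠ 1) (h2 : u ≠ -1) : sfun 0 u = u := by
  simp [sfun, h1, h2]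

/-- Left multiplication of `π` by the simple generator `s_v`. -/
def SignedPerm.mulGen {n : ℕ} (π : SignedPerm n) (v : ℕ) (hv : v + 1 ≤ n) : SignedPerm n where
  perm := π.perm.trans (sfun_involutive v).toPerm
  sign_symm i := by
    simp [π.sign_symm, sfun_neg]
  outside i hi := by
    have h := π.outside i hi
    simp only [Equiv.trans_apply, Function.Involutive.coe_toPerm, h, sfun]
    have : |i| = i ∨ |i| = -i := abs_choice i
    split_ifs <;> omega

/-- The identity signed permutation. -/
def SignedPerm.id (n : ℕ) : SignedPerm n where
  perm := Equiv.refl ℤ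
  sign_symm _ := rfl
  outside _ _ := rfl

section Basic

variable {n : ℕ} (π : SignedPerm n)

theorem SignedPerm.mulGen_perm (v : ℕ) (hv : v + 1 ≤ n) (i : ℤ) :
    (π.mulGen v hv).perm i = sfun v (π.perm i) := rfl

theorem SignedPerm.perm_zero : π.perm 0 = 0 := by
  have := π.sign_symm 0
  simp only [neg_zero] at this
  omega

theorem SignedPerm.perm_ne_zero {i : ℤ} (hi : 1 ≤ i) : π.perm i ≠ 0 := by
  intro h
  have := π.perm.injective (h.trans π.perm_zero.symm)
  omega

theorem SignedPerm.abs_perm_le {i : ℤ} (h1 : 1 ≤ i) (h2 : i ≤ n) :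
    -(n : ℤ) ≤ π.perm i ∧ π.perm i ≤ n := by
  rw [← abs_le]
  by_contra! h
  have h3 := π.perm.injective (π.outside _ h)
  rw [h3, abs_of_pos (by omega)] at h
  omega

theorem SignedPerm.eq_of_perm {i j : ℤ} (hi : 1 ≤ i) (hj : 1 ≤ j)
    (h : π.perm i = π.perm j ∨ π.perm i = -π.perm j) : i = j := by
  rcases h with h | h
  · exact π.perm.injective h
  · rw [← π.sign_symm] at h
    have := π.perm.injective h
    omega

theorem SignedPerm.exists_perm {w : ℤ} (h1 : 1 ≤ w) (h2 : w ≤ n) :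
    ∃ x : ℤ, 1 ≤ x ∧ x ≤ n ∧ (π.perm x = w ∨ π.perm x = -w) := by
  obtain ⟨y, rfl⟩ := π.perm.surjective w
  have hy0 : y ≠ 0 := by
    rintro rfl
    rw [π.perm_zero] at h1
    omega
  have hyn : |y| ≤ n := by
    by_contra! h
    rw [π.outside y h] at h1 h2
    rw [abs_of_pos (by omega)] at h
    omega
  rw [abs_le] at hyn
  rcases lt_or_gt_of_ne hy0 with h | h
  · exact ⟨-y, by omega, by omega, Or.inr (π.sign_symm y)⟩
  · exact ⟨y, by omega, by omega, Or.inl rfl⟩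

variable {π}

theorem neg_mem_Inv {i : ℕ} : BInv.neg i ∈ Inv π ↔ 1 ≤ i ∧ i ≤ n ∧ π.perm (i : ℤ) < 0 := Iff.rfl

theorem pair_mem_Inv {i j : ℕ} : BInv.pair i j ∈ Inv π ↔
    1 ≤ i ∧ i < j ∧ j ≤ n ∧ π.perm (j : ℤ) < π.perm (i : ℤ) := Iff.rfl

theorem mixed_mem_Inv {i j : ℕ} : BInv.mixed i j ∈ Inv π ↔
    1 ≤ i ∧ i < j ∧ j ≤ n ∧ π.perm (i : ℤ) + π.perm (j : ℤ) < 0 := Iff.rfl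

/-- `σ` has exactly one more inversion than `π`. -/
def AddsOne (π σ : SignedPerm n) : Prop := ∃ t, t ∉ Inv π ∧ Inv σ = insert t (Inv π)

theorem addsOne_mulGen_zero (hn : 0 + 1 ≤ n) {p : ℤ} (hp : 1 ≤ p) (hpn : p ≤ n)
    (h : π.perm p = 1) : AddsOne π (π.mulGen 0 hn) := by
  lift p to ℕ using by omega
  have key : ∀ i : ℕ, 1 ≤ i → i ≠ p → sfun 0 (π.perm i) = π.perm i := by
    intro i hi hip
    apply sfun_zero_of_ne
    · intro h'
      have := π.eq_of_perm (i := i) (j := p) (by omega) (by omega) (by omega)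
      omega
    · intro h'
      have := π.eq_of_perm (i := i) (j := p) (by omega) (by omega) (by omega)
      omega
  have ne : ∀ i : ℕ, 1 ≤ i → i ≠ p → π.perm i ≠ 1 ∧ π.perm i ≠ -1 ∧ π.perm i ≠ 0 := by
    intro i hi hip
    refine ⟨fun h' => ?_, fun h' => ?_, π.perm_ne_zero (by omega)⟩
    all_goals
      have := π.eq_of_perm (i := i) (j := p) (by omega) (by omega) (by omega)
      omega
  have hs : sfun 0 (π.perm p) = -1 := by simp [sfun, h]
  refine ⟨.neg p, ?_, ?_⟩
  · rw [neg_mem_Inv]; omega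
  · ext t
    rw [Set.mem_insert_iff]
    rcases t with i | ⟨i, j⟩ | ⟨i, j⟩
    · simp only [neg_mem_Inv, SignedPerm.mulGen_perm, BInv.neg.injEq]
      by_cases hip : i = p
      · subst hip; omega
      · by_cases hi : 1 ≤ i
        · rw [key i hi hip]; omega
        · omega
    · simp only [pair_mem_Inv, SignedPerm.mulGen_perm, reduceCtorEq, false_or]
      refine and_congr_right fun hi => and_congr_right fun hij => and_congr_right fun hj => ?_
      have ki := key i hi
      have kj := key j (by omega)
      have ni := ne i hi
      have nj := ne j (by omega)
      rcases eq_or_ne i p with rfl | hip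
      · specialize kj (by omega); specialize nj (by omega); omega
      · specialize ki hip; specialize ni hip
        rcases eq_or_ne j p with rfl | hjp
        · omega
        · specialize kj hjp; omega
    · simp only [mixed_mem_Inv, SignedPerm.mulGen_perm, reduceCtorEq, false_or]
      refine and_congr_right fun hi => and_congr_right fun hij => and_congr_right fun hj => ?_
      have ki := key i hi
      have kj := key j (by omega)
      have ni := ne i hi
      have nj := ne j (by omega)
      rcases eq_or_ne i p with rfl | hip
      · specialize kj (by omega); specialize nj (by omega); omega
      · specialize ki hip; specialize ni hip
        rcases eq_or_ne j p with rfl | hjp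
        · omega
        · specialize kj hjp; omega

theorem sfun_perm_lt_iff {v : ℕ} (hv : 1 ≤ v) {x a : ℤ} (hx : 1 ≤ x) (ha : 1 ≤ a)
    (h : (π.perm x = v ∨ π.perm x = -v) ∧ (π.perm a = v + 1 ∨ π.perm a = -v - 1) ∨
      (π.perm a = v ∨ π.perm a = -v) ∧ (π.perm x = v + 1 ∨ π.perm x = -v - 1))
    {i j : ℤ} (hi : 1 ≤ i) (hij : i < j) (hne : ¬(i = x ∧ j = a) ∧ ¬(i = a ∧ j = x)) :
    (sfun v (π.perm j) < sfun v (π.perm i) ↔ π.perm j < π.perm i) ∧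
    (sfun v (π.perm i) + sfun v (π.perm j) < 0 ↔ π.perm i + π.perm j < 0) := by
  have h1 : π.perm i = π.perm x ∨ π.perm i = -π.perm x → i = x := π.eq_of_perm hi hx
  have h2 : π.perm i = π.perm a ∨ π.perm i = -π.perm a → i = a := π.eq_of_perm hi ha
  have h3 : π.perm j = π.perm x ∨ π.perm j = -π.perm x → j = x := π.eq_of_perm (by omega) hx
  have h4 : π.perm j = π.perm a ∨ π.perm j = -π.perm a → j = a := π.eq_of_perm (by omega) ha
  have h5 : ¬(π.perm i = v ∧ (π.perm j = v + 1 ∨ π.perm j = -v - 1)) ∧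
      ¬(π.perm i = -v ∧ (π.perm j = v + 1 ∨ π.perm j = -v - 1)) ∧
      ¬(π.perm j = v ∧ (π.perm i = v + 1 ∨ π.perm i = -v - 1)) ∧
      ¬(π.perm j = -v ∧ (π.perm i = v + 1 ∨ π.perm i = -v - 1)) := by
    refine ⟨?_, ?_, ?_, ?_⟩ <;> intro h' <;> rcases h with h | h
    · exact hne.1 ⟨h1 (by omega), h4 (by omega)⟩
    · exact hne.2 ⟨h2 (by omega), h3 (by omega)⟩
    · exact hne.1 ⟨h1 (by omega), h4 (by omega)⟩
    · exact hne.2 ⟨h2 (by omega), h3 (by omega)⟩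
    · exact hne.2 ⟨h2 (by omega), h3 (by omega)⟩
    · exact hne.1 ⟨h1 (by omega), h4 (by omega)⟩
    · exact hne.2 ⟨h2 (by omega), h3 (by omega)⟩
    · exact hne.1 ⟨h1 (by omega), h4 (by omega)⟩
  clear h1 h2 h3 h4 h hne
  constructor
  · apply sfun_lt_iff hv <;> omega
  · have e1 : sfun v (π.perm i) + sfun v (π.perm j) < 0 ↔
        sfun v (π.perm i) < sfun v (-π.perm j) := by rw [sfun_neg]; omega
    rw [e1, sfun_lt_iff hv] <;> omega

theorem addsOne_mulGen_pair {v : ℕ} (hv : 1 ≤ v) (hvn : v + 1 ≤ n) {x a : ℤ} (hx : 1 ≤ x)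
    (hxa : x < a) (han : a ≤ n)
    (h : π.perm x = v ∧ π.perm a = v + 1 ∨ π.perm x = -v - 1 ∧ π.perm a = -v) :
    AddsOne π (π.mulGen v hvn) := by
  lift x to ℕ using by omega
  lift a to ℕ using by omega
  have key := fun i j : ℕ => sfun_perm_lt_iff (π := π) hv (x := x) (a := a) (by omega) (by omega)
    (by omega) (i := i) (j := j)
  have hv0 : v ≠ 0 := by omega
  have hs : π.perm x = v ∧ sfun v (π.perm x) = v + 1 ∧ sfun v (π.perm a) = v ∨
      π.perm x = -v - 1 ∧ sfun v (π.perm x) = -v ∧ sfun v (π.perm a) = -v - 1 := by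
    simp only [sfun, hv0, if_false]
    split_ifs <;> omega
  refine ⟨.pair x a, ?_, ?_⟩
  · rw [pair_mem_Inv]; omega
  · ext t
    rw [Set.mem_insert_iff]
    rcases t with i | ⟨i, j⟩ | ⟨i, j⟩
    · simp [neg_mem_Inv, SignedPerm.mulGen_perm, sfun_neg_iff hv]
    · simp only [pair_mem_Inv, SignedPerm.mulGen_perm, BInv.pair.injEq]
      by_cases hij : 1 ≤ i ∧ i < j
      · by_cases he : i = x ∧ j = a
        · obtain ⟨rfl, rfl⟩ := he; omega
        · rw [(key i j (by omega) (by omega) (by omega)).1]; omega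
      · omega
    · simp only [mixed_mem_Inv, SignedPerm.mulGen_perm, reduceCtorEq, false_or]
      refine and_congr_right fun hi => and_congr_right fun hij => and_congr_right fun hj => ?_
      by_cases he : i = x ∧ j = a
      · obtain ⟨rfl, rfl⟩ := he; omega
      · exact (key i j (by omega) (by omega) (by omega)).2

theorem addsOne_mulGen_mixed {v : ℕ} (hv : 1 ≤ v) (hvn : v + 1 ≤ n) {x a : ℤ} (hx : 1 ≤ x)
    (hxa : x < a) (han : a ≤ n)
    (h : π.perm x = v + 1 ∧ π.perm a = -v ∨ π.perm x = -v ∧ π.perm a = v + 1) :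
    AddsOne π (π.mulGen v hvn) := by
  lift x to ℕ using by omega
  lift a to ℕ using by omega
  have key := fun i j : ℕ => sfun_perm_lt_iff (π := π) hv (x := x) (a := a) (by omega) (by omega)
    (by omega) (i := i) (j := j)
  have hv0 : v ≠ 0 := by omega
  have hs : π.perm x = v + 1 ∧ sfun v (π.perm x) = v ∧ sfun v (π.perm a) = -v - 1 ∨
      π.perm x = -v ∧ sfun v (π.perm x) = -v - 1 ∧ sfun v (π.perm a) = v := by
    simp only [sfun, hv0, if_false]
    split_ifs <;> omega
  refine ⟨.mixed x a, ?_, ?_⟩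
  · rw [mixed_mem_Inv]; omega
  · ext t
    rw [Set.mem_insert_iff]
    rcases t with i | ⟨i, j⟩ | ⟨i, j⟩
    · simp [neg_mem_Inv, SignedPerm.mulGen_perm, sfun_neg_iff hv]
    · simp only [pair_mem_Inv, SignedPerm.mulGen_perm, reduceCtorEq, false_or]
      refine and_congr_right fun hi => and_congr_right fun hij => and_congr_right fun hj => ?_
      by_cases he : i = x ∧ j = a
      · obtain ⟨rfl, rfl⟩ := he; omega
      · exact (key i j (by omega) (by omega) (by omega)).1
    · simp only [mixed_mem_Inv, SignedPerm.mulGen_perm, BInv.mixed.injEq]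
      by_cases hij : 1 ≤ i ∧ i < j
      · by_cases he : i = x ∧ j = a
        · obtain ⟨rfl, rfl⟩ := he; omega
        · rw [(key i j (by omega) (by omega) (by omega)).2]; omega
      · omega

end Basic

section Phases

variable {n : ℕ}

/-- All values are positive; the position `a` is being moved below the values at positions
`1, …, m`, all the positions between `m` and `a` already being below them. -/
structure LiftPhase (m : ℕ) (π : SignedPerm n) (a : ℤ) : Prop where
  lt : m < a
  le : a ≤ n + 1
  pos : ∀ x : ℤ, 1 ≤ x → x ≤ n → 0 < π.perm x
  incLow : ∀ x y : ℤ, 1 ≤ x → x < y → y ≤ m → π.perm x < π.perm y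
  incHigh : ∀ x y : ℤ, m < x → x < y → y ≤ n → π.perm x < π.perm y
  before : ∀ x y : ℤ, 1 ≤ x → x ≤ m → m < y → y < a → π.perm y < π.perm x
  after : ∀ x y : ℤ, 1 ≤ x → x ≤ m → a < y → y ≤ n → π.perm x < π.perm y

/-- The position `a` is being moved down to the bottom of its region (with regions given by `ρ`);
the positions between `m` and `a` are already negative and carry the largest absolute values. -/
structure SinkPhase (m : ℕ) (ρ : ℤ → ℕ) (π : SignedPerm n) (a : ℤ) : Prop where
  lt : m < a
  le : a ≤ n + 1
  posLow : ∀ x : ℤ, 1 ≤ x → x ≤ m → 0 < π.perm x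
  incLow : ∀ x y : ℤ, 1 ≤ x → x < y → y ≤ m → π.perm x < π.perm y
  posRest : ∀ x : ℤ, a < x → x ≤ n → 0 < π.perm x
  incRest : ∀ x y : ℤ, a < x → x < y → y ≤ n → π.perm x < π.perm y
  restLow : ∀ x y : ℤ, a < x → x ≤ n → 1 ≤ y → y ≤ m → π.perm x < π.perm y
  priorNeg : ∀ x : ℤ, m < x → x < a → π.perm x < 0
  priorLow : ∀ x y : ℤ, m < x → x < a → 1 ≤ y → y ≤ m → π.perm x + π.perm y < 0
  priorRest : ∀ x y : ℤ, m < x → x < a → a < y → y ≤ n → π.perm x + π.perm y < 0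
  priorInc : ∀ x y : ℤ, m < x → x < y → y < a → ρ x = ρ y → π.perm x < π.perm y
  priorDec : ∀ x y : ℤ, m < x → x < y → y < a → ρ x ≠ ρ y → π.perm y < π.perm x
  curPrior : ∀ x : ℤ, m < x → x < a → a ≤ n → ρ x = ρ a → π.perm x < π.perm a
  curPos : a ≤ n → 0 < π.perm a → π.perm a = 1

variable {m : ℕ} {ρ : ℤ → ℕ} {π : SignedPerm n} {a : ℤ}

theorem LiftPhase.step (hm : m ≤ n) (h : LiftPhase m π a) (ha : a ≤ n) :
    (∃ σ, LiftPhase m σ a ∧ AddsOne π σ) ∨ LiftPhase m π (a + 1) := by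
  have ham := h.lt
  by_cases hx : ∃ x : ℤ, 1 ≤ x ∧ x ≤ m ∧ π.perm x + 1 = π.perm a
  · left
    obtain ⟨x, hx1, hxm, hxa⟩ := hx
    obtain ⟨v, hv⟩ : ∃ v : ℕ, π.perm x = v :=
      ⟨_, (Int.toNat_of_nonneg (h.pos x hx1 (by omega)).le).symm⟩
    have hv1 : 1 ≤ v := by have := h.pos x hx1 (by omega); omega
    have hvn : v + 1 ≤ n := by have := π.abs_perm_le (i := a) (by omega) ha; omega
    have ex : ∀ y : ℤ, 1 ≤ y → π.perm y = v → y = x := fun y hy hyv =>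
      π.eq_of_perm hy hx1 (by omega)
    have ea : ∀ y : ℤ, 1 ≤ y → π.perm y = v + 1 → y = a := fun y hy hyv =>
      π.eq_of_perm hy (by omega) (by omega)
    have key : ∀ y z : ℤ, 1 ≤ y → 1 ≤ z → y ≤ n → z ≤ n → ¬(y = x ∧ z = a) →
        π.perm y < π.perm z → sfun v (π.perm y) < sfun v (π.perm z) := by
      intro y z hy hz hyn hzn hne hlt
      have h1 := h.pos y hy hyn
      have h2 := h.pos z hz hzn
      have h3 := ex y hy
      have h4 := ea z hz
      rw [sfun_lt_iff hv1] <;> omega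
    refine ⟨π.mulGen v hvn, ⟨h.lt, h.le, ?_, ?_, ?_, ?_, ?_⟩,
      addsOne_mulGen_pair hv1 hvn hx1 (by omega) ha (Or.inl ⟨hv, by omega⟩)⟩ <;>
      simp only [SignedPerm.mulGen_perm]
    · intro y hy hyn
      have := sfun_neg_iff hv1 (-π.perm y)
      rw [sfun_neg] at this
      have := h.pos y hy hyn
      omega
    · intro y z hy hyz hzm
      exact key y z hy (by omega) (by omega) (by omega) (by omega) (h.incLow y z hy hyz hzm)
    · intro y z hy hyz hzm
      exact key y z (by omega) (by omega) (by omega) (by omega) (by omega) (h.incHigh y z hy hyz hzm)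
    · intro y z hy hym hz hza
      exact key z y (by omega) (by omega) (by omega) (by omega) (by omega)
        (h.before y z hy hym hz hza)
    · intro y z hy hym hz hza
      exact key y z (by omega) (by omega) (by omega) (by omega) (by omega)
        (h.after y z hy hym hz hza)
  · right
    refine ⟨by omega, by omega, h.pos, h.incLow, h.incHigh, ?_, fun x y h1 h2 h3 h4 =>
      h.after x y h1 h2 (by omega) h4⟩
    intro x y hx1 hxm hym hya
    rcases (by omega : y < a ∨ y = a) with hya | rfl
    · exact h.before x y hx1 hxm hym hya
    · by_contra! hlt
      have hpx := h.pos x hx1 (by omega)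
      have hpy := h.pos y (by omega) ha
      have hny := π.abs_perm_le (i := y) (by omega) ha
      have hxy : π.perm x ≠ π.perm y := fun h' => by
        have := π.eq_of_perm hx1 (j := y) (by omega) (Or.inl h')
        omega
      obtain ⟨z, hz1, hzn, hz⟩ := π.exists_perm (w := π.perm y - 1) (by omega) (by omega)
      have hpz := h.pos z hz1 hzn
      rcases le_or_gt z m with hzm | hzm
      · exact hx ⟨z, hz1, hzm, by omega⟩
      · rcases lt_trichotomy z y with hzy | rfl | hzy
        · have := h.before x z hx1 hxm hzm hzy
          omega
        · omega
        · have := h.incHigh y z hym hzy hzn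
          omega

theorem LiftPhase.toSinkPhase (hm : m ≤ n) (h : LiftPhase m π (n + 1)) :
    SinkPhase m ρ π (m + 1) := by
  refine ⟨by omega, by omega, fun x h1 h2 => h.pos x h1 (by omega), h.incLow,
    fun x h1 h2 => h.pos x (by omega) h2, fun x y h1 h2 h3 => h.incHigh x y (by omega) h2 h3,
    fun x y h1 h2 h3 h4 => h.before y x h3 h4 (by omega) (by omega),
    by omega, by omega, by omega, by omega, by omega, by omega, ?_⟩
  intro hmn hpos
  obtain ⟨z, hz1, hzn, hz⟩ := π.exists_perm (w := 1) (by omega) (by omega)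
  have hpz := h.pos z hz1 hzn
  rcases lt_trichotomy z (m + 1) with hzm | rfl | hzm
  · have := h.before z (m + 1) hz1 (by omega) (by omega) (by omega)
    omega
  · omega
  · have := h.incHigh (m + 1) z (by omega) hzm hzn
    omega

theorem SinkPhase.succ (h : SinkPhase m ρ π a) (ha : a ≤ n) (hneg : π.perm a < 0)
    (hlow : ∀ y : ℤ, 1 ≤ y → y ≤ m → π.perm a + π.perm y < 0)
    (hrest : ∀ y : ℤ, a < y → y ≤ n → π.perm a + π.perm y < 0)
    (hdec : ∀ x : ℤ, m < x → x < a → ρ x ≠ ρ a → π.perm a < π.perm x) :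
    SinkPhase m ρ π (a + 1) := by
  have hma := h.lt
  have split : ∀ x : ℤ, x < a + 1 → x < a ∨ x = a := by omega
  refine ⟨by omega, by omega, h.posLow, h.incLow,
    fun x h1 h2 => h.posRest x (by omega) h2, fun x y h1 h2 h3 => h.incRest x y (by omega) h2 h3,
    fun x y h1 h2 h3 h4 => h.restLow x y (by omega) h2 h3 h4, ?_, ?_, ?_, ?_, ?_, ?_, ?_⟩
  · intro x h1 h2
    rcases split x h2 with h2 | rfl
    · exact h.priorNeg x h1 h2
    · exact hneg
  · intro x y h1 h2 h3 h4
    rcases split x h2 with h2 | rfl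
    · exact h.priorLow x y h1 h2 h3 h4
    · exact hlow y h3 h4
  · intro x y h1 h2 h3 h4
    rcases split x h2 with h2 | rfl
    · exact h.priorRest x y h1 h2 (by omega) h4
    · exact hrest y (by omega) h4
  · intro x y h1 h2 h3 h4
    rcases split y h3 with h3 | rfl
    · exact h.priorInc x y h1 h2 h3 h4
    · exact h.curPrior x h1 h2 ha h4
  · intro x y h1 h2 h3 h4
    rcases split y h3 with h3 | rfl
    · exact h.priorDec x y h1 h2 h3 h4
    · exact hdec x h1 h2 h4
  · intro x h1 h2 h3 h4
    have hpos := h.posRest (a + 1) (by omega) h3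
    rcases split x h2 with h2 | rfl
    · have := h.priorNeg x h1 h2
      omega
    · omega
  · intro h1 h2
    obtain ⟨z, hz1, hzn, hz⟩ := π.exists_perm (w := 1) (by omega) (by omega)
    rcases le_or_gt z m with hzm | hzm
    · have := h.restLow (a + 1) z (by omega) h1 hz1 hzm
      have := h.posLow z hz1 hzm
      omega
    · rcases lt_trichotomy z a with hza | rfl | hza
      · have := h.priorRest z (a + 1) hzm hza (by omega) h1
        omega
      · have := hrest (z + 1) (by omega) h1
        omega
      · rcases (by omega : z = a + 1 ∨ a + 1 < z) with rfl | hza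
        · omega
        · have := h.incRest (a + 1) z (by omega) hza hzn
          have := h.posRest z (by omega) hzn
          omega

theorem SinkPhase.flip (hm : m ≤ n) (h : SinkPhase m ρ π a) (ha : a ≤ n)
    (h1 : π.perm a = 1) : ∃ σ, SinkPhase m ρ σ a ∧ AddsOne π σ := by
  have hma := h.lt
  have hn : 0 + 1 ≤ n := by omega
  have key : ∀ x : ℤ, 1 ≤ x → x ≠ a → sfun 0 (π.perm x) = π.perm x := by
    intro x hx hxa
    apply sfun_zero_of_ne <;> intro h' <;>
      exact hxa (π.eq_of_perm hx (by omega) (by omega))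
  have hs : sfun 0 (π.perm a) = -1 := by simp [sfun, h1]
  refine ⟨π.mulGen 0 hn, ⟨h.lt, h.le, ?_, ?_, ?_, ?_, ?_, ?_, ?_, ?_, ?_, ?_, ?_, ?_⟩,
    addsOne_mulGen_zero hn (by omega) ha h1⟩ <;> simp only [SignedPerm.mulGen_perm]
  · intro x _ _
    rw [key x (by omega) (by omega)]; apply h.posLow <;> assumption
  · intro x y _ _ _
    rw [key x (by omega) (by omega), key y (by omega) (by omega)]; apply h.incLow <;> assumption
  · intro x _ _
    rw [key x (by omega) (by omega)]; apply h.posRest <;> assumption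
  · intro x y _ _ _
    rw [key x (by omega) (by omega), key y (by omega) (by omega)]; apply h.incRest <;> assumption
  · intro x y _ _ _ _
    rw [key x (by omega) (by omega), key y (by omega) (by omega)]; apply h.restLow <;> assumption
  · intro x _ _
    rw [key x (by omega) (by omega)]; apply h.priorNeg <;> assumption
  · intro x y _ _ _ _
    rw [key x (by omega) (by omega), key y (by omega) (by omega)]; apply h.priorLow <;> assumption
  · intro x y _ _ _ _
    rw [key x (by omega) (by omega), key y (by omega) (by omega)]; apply h.priorRest <;> assumption
  · intro x y _ _ _ _
    rw [key x (by omega) (by omega), key y (by omega) (by omega)]; apply h.priorInc <;> assumption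
  · intro x y _ _ _ _
    rw [key x (by omega) (by omega), key y (by omega) (by omega)]; apply h.priorDec <;> assumption
  · intro x hx hxa _ _
    rw [key x (by omega) (by omega), hs]
    have := h.priorNeg x hx hxa
    have : π.perm x ≠ -1 := fun h' => by
      have := π.eq_of_perm (i := x) (j := a) (by omega) (by omega) (by omega)
      omega
    omega
  · omega

/-- Swapping the values `v` and `v + 1` in absolute value preserves `SinkPhase` when the current
position `a` has value `-v`, provided the other position is not earlier in the same region. -/
theorem SinkPhase.mulGen (h : SinkPhase m ρ π a) {v : ℕ} (hv : 1 ≤ v)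
    (hvn : v + 1 ≤ n) (hav : π.perm a = -v) {x : ℤ} (hx : 1 ≤ x)
    (hxv : π.perm x = v + 1 ∨ π.perm x = -(v + 1)) (hxρ : m < x → x < a → ρ x ≠ ρ a) :
    SinkPhase m ρ (π.mulGen v hvn) a := by
  have hma := h.lt
  have ea : ∀ y : ℤ, 1 ≤ y → π.perm y = v ∨ π.perm y = -v → y = a := fun y hy hyv =>
    π.eq_of_perm hy (by omega) (by omega)
  have ex : ∀ y : ℤ, 1 ≤ y → π.perm y = v + 1 ∨ π.perm y = -(v + 1) → y = x := fun y hy hyv =>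
    π.eq_of_perm hy hx (by omega)
  have pos : ∀ y : ℤ, 0 < π.perm y → 0 < sfun v (π.perm y) := by
    intro y hy
    have := sfun_neg_iff hv (-π.perm y)
    rw [sfun_neg] at this
    omega
  have lt : ∀ y z : ℤ, 1 ≤ y → 1 ≤ z → ¬(y = x ∧ z = a) → y ≠ a →
      π.perm y < π.perm z → sfun v (π.perm y) < sfun v (π.perm z) := by
    intro y z hy hz hne hne' hlt
    have h1 := ea y hy
    have h2 := ea z hz
    have h3 := ex y hy
    have h4 := ex z hz
    rw [sfun_lt_iff hv] <;> omega
  have add : ∀ y z : ℤ, 1 ≤ y → 1 ≤ z → y ≠ a → z ≠ a →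
      π.perm y + π.perm z < 0 → sfun v (π.perm y) + sfun v (π.perm z) < 0 := by
    intro y z hy hz hne hne' hlt
    have h1 := ea y hy
    have h2 := ea z hz
    have : sfun v (π.perm y) < sfun v (-π.perm z) := by
      rw [sfun_lt_iff hv] <;> omega
    rw [sfun_neg] at this
    omega
  refine ⟨h.lt, h.le, ?_, ?_, ?_, ?_, ?_, ?_, ?_, ?_, ?_, ?_, ?_, ?_⟩ <;>
    simp only [SignedPerm.mulGen_perm]
  · intro y _ _
    apply pos; apply h.posLow <;> assumption
  · intro y z _ _ _
    apply lt y z (by omega) (by omega) (by omega) (by omega); apply h.incLow <;> assumption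
  · intro y _ _
    apply pos; apply h.posRest <;> assumption
  · intro y z _ _ _
    apply lt y z (by omega) (by omega) (by omega) (by omega); apply h.incRest <;> assumption
  · intro y z _ _ _ _
    apply lt y z (by omega) (by omega) (by omega) (by omega); apply h.restLow <;> assumption
  · intro y _ _
    rw [sfun_neg_iff hv]; apply h.priorNeg <;> assumption
  · intro y z _ _ _ _
    apply add y z (by omega) (by omega) (by omega) (by omega); apply h.priorLow <;> assumption
  · intro y z _ _ _ _
    apply add y z (by omega) (by omega) (by omega) (by omega); apply h.priorRest <;> assumption
  · intro y z _ _ _ _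
    apply lt y z (by omega) (by omega) (by omega) (by omega); apply h.priorInc <;> assumption
  · intro y z _ _ _ _
    apply lt z y (by omega) (by omega) (by omega) (by omega); apply h.priorDec <;> assumption
  · intro y hy hya hay hρ
    apply lt y a (by omega) (by omega) ?_ (by omega)
    · apply h.curPrior <;> assumption
    · rintro ⟨rfl, -⟩
      exact hxρ hy hya hρ
  · intro _ hp
    have := sfun_neg_iff hv (π.perm a)
    omega

theorem SinkPhase.step (hm : m ≤ n) (h : SinkPhase m ρ π a) (ha : a ≤ n)
    (hρ : ∀ x y z : ℤ, m < x → x ≤ y → y ≤ z → ρ x = ρ z → ρ x = ρ y) :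
    (∃ σ, SinkPhase m ρ σ a ∧ AddsOne π σ) ∨ SinkPhase m ρ π (a + 1) := by
  have hma := h.lt
  have h0 := π.perm_ne_zero (i := a) (by omega)
  rcases lt_or_gt_of_ne h0 with hneg | hpos
  swap
  · exact Or.inl (h.flip hm ha (h.curPos ha hpos))
  obtain ⟨v, hv⟩ : ∃ v : ℕ, π.perm a = -v := ⟨(-π.perm a).toNat, by omega⟩
  have hv1 : 1 ≤ v := by omega
  have hbd := π.abs_perm_le (i := a) (by omega) ha
  by_cases hvn : v + 1 ≤ n
  · obtain ⟨x, hx1, hxn, hx⟩ := π.exists_perm (w := v + 1) (by omega) (by omega)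
    rcases le_or_gt x m with hxm | hxm
    · have := h.posLow x hx1 hxm
      exact Or.inl ⟨π.mulGen v hvn, h.mulGen hv1 hvn hv hx1 hx (by omega),
        addsOne_mulGen_mixed hv1 hvn hx1 (by omega) ha (by omega)⟩
    rcases lt_trichotomy x a with hxa | rfl | hxa
    · have hxneg := h.priorNeg x hxm hxa
      by_cases hr : ρ x = ρ a
      · right
        refine h.succ ha hneg ?_ ?_ ?_
        · intro y hy hym
          have h1 := h.priorLow x y hxm hxa hy hym
          have : π.perm y ≠ v := fun h' => by
            have := π.eq_of_perm hy (j := a) (by omega) (by omega)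
            omega
          omega
        · intro y hy hyn
          have h1 := h.priorRest x y hxm hxa hy hyn
          have : π.perm y ≠ v := fun h' => by
            have := π.eq_of_perm (i := y) (j := a) (by omega) (by omega) (by omega)
            omega
          omega
        · intro y hy hya hyr
          have hyx : y < x := by
            rcases lt_trichotomy y x with h' | rfl | h'
            · exact h'
            · exact absurd hr hyr
            · have := hρ x y a hxm h'.le hya.le hr
              omega
          have h1 := h.priorDec y x hy hyx hxa (by omega)
          have : π.perm y ≠ π.perm a := fun h' => by
            have := π.eq_of_perm (i := y) (j := a) (by omega) (by omega) (by omega)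
            omega
          omega
      · exact Or.inl ⟨π.mulGen v hvn, h.mulGen hv1 hvn hv hx1 hx (fun _ _ => hr),
          addsOne_mulGen_pair hv1 hvn hx1 hxa ha (by omega)⟩
    · omega
    · have := h.posRest x hxa hxn
      exact Or.inl ⟨π.mulGen v hvn, h.mulGen hv1 hvn hv hx1 hx (by omega),
        addsOne_mulGen_mixed hv1 hvn (by omega) hxa hxn (by omega)⟩
  · right
    have lt : ∀ y : ℤ, 1 ≤ y → y ≤ n → y ≠ a → π.perm y < n ∧ -(n : ℤ) < π.perm y := by
      intro y hy hyn hya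
      have h1 := π.abs_perm_le hy hyn
      have : ¬(π.perm y = n ∨ π.perm y = -n) := fun h' => by
        have := π.eq_of_perm hy (j := a) (by omega) (by omega)
        omega
      omega
    refine h.succ ha hneg ?_ ?_ ?_
    · intro y hy hym
      have := lt y hy (by omega) (by omega)
      omega
    · intro y hy hym
      have := lt y (by omega) (by omega) (by omega)
      omega
    · intro y hy hym _
      have := lt y (by omega) (by omega) (by omega)
      omega

end Phases

section Regions

variable {n : ℕ} (α : BComp n)

theorem pSum_mono : Monotone (pSum α) := by
  intro i j hij
  exact (List.take_sublist_take_left hij).sum_le_sum (by simp)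

theorem pSum_succ {k : ℕ} (hk : k < α.parts.length) :
    pSum α (k + 1) = pSum α k + α.parts[k] :=
  List.sum_take_succ _ _ hk

theorem pSum_length : pSum α α.parts.length = n := by
  simp [pSum, α.sum_eq]

theorem pSum_one : pSum α 1 = alpha1 α := by
  unfold pSum alpha1
  cases α.parts <;> simp

theorem alpha1_le : alpha1 α ≤ n := by
  rw [← pSum_one]
  unfold pSum
  conv_rhs => rw [← α.sum_eq]
  exact (List.take_sublist _ _).sum_le_sum (by simp)

theorem region_mono : Monotone (region α) := by
  intro a b hab
  refine Finset.card_le_card fun j => ?_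
  simp only [Finset.mem_filter]
  exact fun h => ⟨h.1, h.2.trans_le hab⟩

variable {α}

theorem region_eq {k a : ℕ} (hk : k < α.parts.length) (h1 : pSum α k < a)
    (h2 : a ≤ pSum α (k + 1)) : region α a = k + 1 := by
  have : (Finset.range α.parts.length).filter (fun j => pSum α j < a) = Finset.range (k + 1) := by
    ext j
    simp only [Finset.mem_filter, Finset.mem_range]
    constructor
    · rintro ⟨-, h⟩
      by_contra! hj
      have := pSum_mono α hj
      omega
    · intro hj
      have := pSum_mono α (Nat.lt_succ_iff.1 hj)
      omega
  rw [region, this, Finset.card_range]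

theorem exists_region_index {a : ℕ} (h1 : 1 ≤ a) (h2 : a ≤ n) :
    ∃ k < α.parts.length, pSum α k < a ∧ a ≤ pSum α (k + 1) := by
  have hex : ∃ k, a ≤ pSum α k := ⟨_, h2.trans (pSum_length α).ge⟩
  have h0 : Nat.find hex ≠ 0 := by
    intro h
    have := Nat.find_spec hex
    rw [h] at this
    simp only [pSum, List.take_zero, List.sum_nil] at this
    omega
  obtain ⟨k, hk⟩ := Nat.exists_eq_succ_of_ne_zero h0
  have hlt : ¬ a ≤ pSum α k := Nat.find_min hex (by omega)
  refine ⟨k, ?_, by omega, ?_⟩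
  · by_contra! hlen
    have := pSum_mono α hlen
    rw [pSum_length] at this
    omega
  · have := Nat.find_spec hex
    rwa [hk] at this

theorem region_pos {a : ℕ} (h1 : 1 ≤ a) (h2 : a ≤ n) : 0 < region α a := by
  obtain ⟨k, hk, h3, h4⟩ := exists_region_index (α := α) h1 h2
  rw [region_eq hk h3 h4]
  omega

theorem region_eq_one_iff {a : ℕ} (h1 : 1 ≤ a) (h2 : a ≤ n) :
    region α a = 1 ↔ a ≤ alpha1 α := by
  obtain ⟨k, hk, h3, h4⟩ := exists_region_index (α := α) h1 h2
  rw [region_eq hk h3 h4, ← pSum_one]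
  constructor
  · intro h
    obtain rfl : k = 0 := by omega
    exact h4
  · intro h
    by_contra hk0
    have := pSum_mono α (show 1 ≤ k by omega)
    omega

variable (α)

/-- The largest positive element of the block of `Part(α)` that is symmetric about `0`
(`0` when there is no such block). -/
def center : ℕ := if α.isJoin = true then alpha1 α else 0

theorem center_le : center α ≤ n := by
  unfold center
  have := alpha1_le α
  split_ifs <;> omega

/-- The region of an integer position. -/
def regionZ (x : ℤ) : ℕ := region α x.toNat

variable {α}

theorem regionZ_eq_of_between {x y z : ℤ} (hxy : x ≤ y) (hyz : y ≤ z)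
    (h : regionZ α x = regionZ α z) : regionZ α x = regionZ α y := by
  have h1 := region_mono α (Int.toNat_le_toNat hxy)
  have h2 := region_mono α (Int.toNat_le_toNat hyz)
  unfold regionZ at *
  omega

theorem blockIdx_of_center_lt {x : ℤ} (h1 : center α < x) (h2 : x ≤ n) :
    blockIdx α x = regionZ α x ∧ 0 < regionZ α x := by
  have hx : 0 < x := by omega
  refine ⟨?_, region_pos (by omega) (by omega)⟩
  rw [blockIdx, if_pos hx, if_neg]
  · rfl
  · rintro ⟨hj, hr⟩
    rw [region_eq_one_iff (by omega) (by omega)] at hr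
    rw [center, if_pos hj] at h1
    omega

theorem blockIdx_neg {x : ℤ} (hx : x ≠ 0) : blockIdx α (-x) = -blockIdx α x := by
  unfold blockIdx
  rcases lt_or_gt_of_ne hx with h | h
  · rw [if_pos (by omega : 0 < -x), if_neg (by omega : ¬ 0 < x)]
    split_ifs <;> omega
  · rw [if_neg (by omega : ¬ 0 < -x), if_pos h, neg_neg]
    split_ifs <;> omega

theorem blockIdx_of_le_center {x : ℤ} (h0 : 1 ≤ x) (h : x ≤ center α) :
    blockIdx α x = 0 := by
  have := alpha1_le α
  unfold center at h
  split_ifs at h with hj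
  · have hr : region α x.toNat = 1 := (region_eq_one_iff (by omega) (by omega)).2 (by omega)
    rw [blockIdx, if_pos (by omega), if_pos ⟨hj, hr⟩]
  · omega

theorem blockIdx_eq_of_region_eq {i j : ℕ} (hi : 1 ≤ i) (hj : 1 ≤ j)
    (h : region α i = region α j) : blockIdx α i = blockIdx α j := by
  unfold blockIdx
  rw [if_pos (by omega : (0 : ℤ) < i), if_pos (by omega : (0 : ℤ) < j)]
  simp [h]

theorem memH_of_increasing {π : SignedPerm n}
    (hpos : ∀ x : ℤ, 1 ≤ x → x ≤ center α → 0 < π.perm x)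
    (hlow : ∀ x y : ℤ, 1 ≤ x → x < y → y ≤ center α → π.perm x < π.perm y)
    (hhigh : ∀ x y : ℤ, center α < x → x < y → y ≤ n → regionZ α x = regionZ α y →
      π.perm x < π.perm y) : memH α π := by
  have hc := center_le α
  have idx : ∀ x : ℤ, inPM n x →
      center α < x ∧ x ≤ n ∧ blockIdx α x = regionZ α x ∧ 0 < regionZ α x ∨
      center α < -x ∧ -x ≤ n ∧ blockIdx α x = -regionZ α (-x) ∧ 0 < regionZ α (-x) ∨
      (1 ≤ x ∧ x ≤ center α ∨ 1 ≤ -x ∧ -x ≤ center α) ∧ blockIdx α x = 0 := by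
    rintro x ⟨h0, h1, h2⟩
    by_cases h3 : (center α : ℤ) < x
    · have := blockIdx_of_center_lt h3 h2
      omega
    by_cases h4 : (center α : ℤ) < -x
    · have := blockIdx_of_center_lt h4 (by omega)
      have := blockIdx_neg (α := α) h0
      omega
    rcases lt_or_gt_of_ne h0 with h | h
    · have := blockIdx_of_le_center (α := α) (x := -x) (by omega) (by omega)
      have := blockIdx_neg (α := α) h0
      omega
    · have := blockIdx_of_le_center (α := α) (x := x) (by omega) (by omega)
      omega
  intro x y hx hy hxy hb
  have sx := π.sign_symm x
  have sy := π.sign_symm y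
  rcases idx x hx with hx | hx | hx <;> rcases idx y hy with hy | hy | hy <;> try omega
  · exact hhigh x y hx.1 hxy hy.2.1 (by omega)
  · have := hhigh (-y) (-x) hy.1 (by omega) hx.2.1 (by omega)
    omega
  · rcases hx.1 with h1 | h1 <;> rcases hy.1 with h2 | h2
    · exact hlow x y h1.1 hxy h2.2
    · omega
    · have := hpos (-x) h1.1 h1.2
      have := hpos y h2.1 h2.2
      omega
    · have := hlow (-y) (-x) h2.1 (by omega) h1.2
      omega

theorem has231.exists_triple {π : SignedPerm n} (h : has231 α π) :
    ∃ i j k : ℤ, -(n : ℤ) ≤ i ∧ i < j ∧ j < k ∧ k ≤ n ∧ 0 < j ∧ i ≠ 0 ∧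
      π.perm i = iplus (π.perm k) ∧
      (center α < j ∧ π.perm i < π.perm j ∧ (center α < i → regionZ α i ≠ regionZ α j) ∨
       j ≤ center α ∧ π.perm j < π.perm k ∧ i < -(center α : ℤ) ∧ center α < k) := by
  obtain ⟨i, j, k, ⟨hi, hj, hk, hij, hjk, hj0, b1, b2, b3, e⟩, hc⟩ := h
  obtain ⟨hi0, hi1, hi2⟩ := hi
  obtain ⟨hk0, hk1, hk2⟩ := hk
  refine ⟨i, j, k, hi1, hij, hjk, hk2, hj0, hi0, e, ?_⟩
  rcases lt_or_ge (center α : ℤ) j with hjc | hjc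
  · left
    refine ⟨hjc, ?_, ?_⟩
    · split_ifs at hc with hJ
      · rw [center, if_pos hJ] at hjc
        exact hc.1 hjc
      · exact hc
    · intro hic hr
      have := blockIdx_of_center_lt hic hi2
      have := blockIdx_of_center_lt hjc hj.2.2
      omega
  · right
    have bj := blockIdx_of_le_center (α := α) (x := j) (by omega) hjc
    refine ⟨hjc, ?_, ?_, ?_⟩
    · unfold center at hjc
      split_ifs at hc hjc with hJ
      · exact hc.2 hjc
      · omega
    · by_contra! hic
      rcases lt_or_gt_of_ne hi0 with h | h
      · have := blockIdx_of_le_center (α := α) (x := -i) (by omega) (by omega)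
        have := blockIdx_neg (α := α) hi0
        omega
      · have := blockIdx_of_le_center (α := α) (x := i) (by omega) (by omega)
        omega
    · by_contra! hkc
      have := blockIdx_of_le_center (α := α) (x := k) (by omega) (by omega)
      omega

theorem LiftPhase.mem231 {π : SignedPerm n} {a : ℤ} (h : LiftPhase (center α) π a) :
    mem231 α π := by
  have hc := center_le α
  refine ⟨memH_of_increasing (fun x h1 h2 => h.pos x h1 (by omega)) h.incLow
    (fun x y h1 h2 h3 _ => h.incHigh x y h1 h2 h3), fun hp => ?_⟩
  obtain ⟨i, j, k, hi, hij, hjk, hk, hj0, hi0, e, hcase⟩ := hp.exists_triple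
  have hpk := h.pos k (by omega) hk
  rw [iplus, if_neg (by omega)] at e
  rcases hcase with ⟨h1, h2, -⟩ | ⟨h1, h2, h3, h4⟩
  · have := h.incHigh j k h1 hjk hk
    omega
  · have := h.pos (-i) (by omega) (by omega)
    rw [π.sign_symm] at this
    omega

theorem SinkPhase.mem231 {π : SignedPerm n} {a : ℤ}
    (h : SinkPhase (center α) (regionZ α) π a) : mem231 α π := by
  have hc := center_le α
  have hca := h.lt
  have si := π.sign_symm
  refine ⟨memH_of_increasing h.posLow h.incLow ?_, fun hp => ?_⟩
  · intro x y hx hxy hy hr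
    rcases lt_trichotomy y a with hya | rfl | hya
    · exact h.priorInc x y hx hxy hya hr
    · exact h.curPrior x hx hxy hy hr
    · have py := h.posRest y hya hy
      rcases lt_trichotomy x a with hxa | rfl | hxa
      · have := h.priorNeg x hx hxa
        omega
      · have := h.curPos (by omega)
        have : π.perm x ≠ π.perm y := fun h' => hxy.ne (π.perm.injective h')
        omega
      · exact h.incRest x y hxa hxy hy
  obtain ⟨i, j, k, hi, hij, hjk, hk, hj0, hi0, e, hcase⟩ := hp.exists_triple
  have sii := si i
  rcases hcase with ⟨h1, h2, h3⟩ | ⟨h1, h2, h3, h4⟩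
  · rcases lt_or_ge j a with hja | hja
    · have hj := h.priorNeg j h1 hja
      rcases lt_or_gt_of_ne hi0 with hineg | hipos
      · rcases le_or_gt (-i) (center α) with hic | hic
        · have := h.priorLow j (-i) h1 hja (by omega) hic
          omega
        rcases lt_trichotomy (-i) a with hia | hia | hia
        · have := h.priorNeg (-i) hic hia
          omega
        · have := h.curPos (by omega)
          rw [← hia] at this
          omega
        · have := h.priorRest j (-i) h1 hja hia (by omega)
          omega
      · rcases le_or_gt i (center α) with hic | hic
        · have := h.posLow i (by omega) hic
          omega
        · have := h.priorDec i j hic hij hja (h3 hic)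
          omega
    · have hkp := h.posRest k (by omega) hk
      rw [iplus, if_neg (by omega)] at e
      rcases (by omega : j = a ∨ a < j) with rfl | hja
      · have := h.curPos (by omega)
        omega
      · have := h.incRest j k hja hjk hk
        omega
  · have hj := h.posLow j hj0 h1
    rw [iplus, if_neg (by omega)] at e
    rcases lt_trichotomy k a with hka | rfl | hka
    · have := h.priorNeg k h4 hka
      omega
    · have := h.curPos hk
      omega
    · have := h.restLow k j hka hk (by omega) h1
      omega

/-- The symbols that can be inversions of elements of `H_α`. -/
def allowed (α : BComp n) : Set (BInv n) := fun t =>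
  match t with
  | .neg i => center α < i ∧ i ≤ n
  | .pair i j => 1 ≤ i ∧ i < j ∧ j ≤ n ∧ region α i ≠ region α j
  | .mixed i j => 1 ≤ i ∧ i < j ∧ j ≤ n ∧ center α < j

theorem Inv_subset_allowed {π : SignedPerm n} (h : memH α π) : Inv π ⊆ allowed α := by
  have hc := center_le α
  have low : ∀ x y : ℤ, 1 ≤ x → x ≤ center α → 1 ≤ y → y ≤ center α →
      -π.perm x < π.perm y := by
    intro x y hx hxc hy hyc
    rw [← π.sign_symm]
    refine h (-x) y ⟨by omega, by omega, by omega⟩ ⟨by omega, by omega, by omega⟩ (by omega) ?_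
    rw [blockIdx_neg (by omega), blockIdx_of_le_center hx hxc, blockIdx_of_le_center hy hyc,
      neg_zero]
  rintro (i | ⟨i, j⟩ | ⟨i, j⟩)
  · rintro ⟨h1, h2, h3⟩
    refine ⟨?_, h2⟩
    by_contra! hi
    have := low i i (by omega) (by omega) (by omega) (by omega)
    omega
  · rintro ⟨h1, h2, h3, h4⟩
    refine ⟨h1, h2, h3, fun hr => ?_⟩
    have := h i j ⟨by omega, by omega, by omega⟩ ⟨by omega, by omega, by omega⟩ (by omega)
      (blockIdx_eq_of_region_eq h1 (by omega) hr)
    omega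
  · rintro ⟨h1, h2, h3, h4⟩
    refine ⟨h1, h2, h3, ?_⟩
    by_contra! hi
    have := low i j (by omega) (by omega) (by omega) (by omega)
    omega

theorem SinkPhase.allowed_subset {π : SignedPerm n}
    (h : SinkPhase (center α) (regionZ α) π (n + 1)) : allowed α ⊆ Inv π := by
  have hc := center_le α
  have neg : ∀ i : ℕ, center α < i → i ≤ n → π.perm i < 0 := fun i h1 h2 =>
    h.priorNeg i (by omega) (by omega)
  rintro (i | ⟨i, j⟩ | ⟨i, j⟩)
  · rintro ⟨h1, h2⟩
    exact ⟨by omega, h2, neg i h1 h2⟩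
  · rintro ⟨h1, h2, h3, h4⟩
    refine ⟨h1, h2, h3, ?_⟩
    rcases le_or_gt i (center α) with hi | hi
    · have := h.posLow i (by omega) (by omega)
      rcases le_or_gt j (center α) with hj | hj
      · refine absurd ?_ h4
        have := alpha1_le α
        unfold center at hi hj
        split_ifs at hi hj with hJ
        · rw [(region_eq_one_iff h1 (by omega)).2 hi,
            (region_eq_one_iff (a := j) (by omega) (by omega)).2 hj]
        · omega
      · have := neg j hj h3
        omega
    · exact h.priorDec i j (by omega) (by omega) (by omega) (by simpa [regionZ] using h4)
  · rintro ⟨h1, h2, h3, h4⟩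
    refine ⟨h1, h2, h3, ?_⟩
    have hj := neg j h4 h3
    rcases le_or_gt i (center α) with hi | hi
    · have := h.priorLow j i (by omega) (by omega) (by omega) (by omega)
      omega
    · have := neg i hi (by omega)
      omega

end Regions

section Counting

/-- The pairs `(i, j)` of elements of `s` with `i < j`. -/
def ltPairs (s : Finset ℕ) : Finset (ℕ × ℕ) := (s ×ˢ s).filter (fun p => p.1 < p.2)

theorem mem_ltPairs {s : Finset ℕ} {p : ℕ × ℕ} :
    p ∈ ltPairs s ↔ p.1 ∈ s ∧ p.2 ∈ s ∧ p.1 < p.2 := by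
  simp [ltPairs, and_assoc]

theorem card_ltPairs (s : Finset ℕ) : (ltPairs s).card = s.card * (s.card - 1) / 2 := by
  have hgt : ((s ×ˢ s).filter (fun p => p.2 < p.1)).card = (ltPairs s).card := by
    refine Finset.card_bij' (fun p _ => p.swap) (fun p _ => p.swap) ?_ ?_ ?_ ?_ <;>
      simp [ltPairs] <;> tauto
  have hoff : s.offDiag = ltPairs s ∪ (s ×ˢ s).filter (fun p => p.2 < p.1) := by
    ext p
    simp only [Finset.mem_offDiag, ltPairs, Finset.mem_union, Finset.mem_filter,
      Finset.mem_product]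
    have : p.1 ≠ p.2 ↔ p.1 < p.2 ∨ p.2 < p.1 := lt_or_lt_iff_ne.symm
    tauto
  have hdisj : Disjoint (ltPairs s) ((s ×ˢ s).filter (fun p => p.2 < p.1)) := by
    rw [Finset.disjoint_left]
    intro p
    simp only [ltPairs, Finset.mem_filter]
    omega
  have h := s.offDiag_card
  rw [hoff, Finset.card_union_of_disjoint hdisj, hgt] at h
  rw [Nat.mul_sub, mul_one, ← h]
  omega

variable {n : ℕ} (α : BComp n)

theorem card_sameRegion :
    ((ltPairs (Finset.Icc 1 n)).filter (fun p => region α p.1 = region α p.2)).card =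
      (α.parts.map (fun a => a * (a - 1) / 2)).sum := by
  have key : (ltPairs (Finset.Icc 1 n)).filter (fun p => region α p.1 = region α p.2) =
      (Finset.range α.parts.length).biUnion
        (fun k => ltPairs (Finset.Ioc (pSum α k) (pSum α (k + 1)))) := by
    ext ⟨i, j⟩
    simp only [Finset.mem_filter, mem_ltPairs, Finset.mem_biUnion, Finset.mem_range,
      Finset.mem_Icc, Finset.mem_Ioc]
    constructor
    · rintro ⟨⟨⟨hi1, hi2⟩, ⟨hj1, hj2⟩, hij⟩, hr⟩
      obtain ⟨k, hk, h1, h2⟩ := exists_region_index (α := α) hi1 hi2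
      obtain ⟨l, hl, h3, h4⟩ := exists_region_index (α := α) hj1 hj2
      rw [region_eq hk h1 h2, region_eq hl h3 h4] at hr
      obtain rfl : k = l := by omega
      exact ⟨k, hk, ⟨h1, h2⟩, ⟨h3, h4⟩, hij⟩
    · rintro ⟨k, hk, ⟨h1, h2⟩, ⟨h3, h4⟩, hij⟩
      have := pSum_mono α (show k + 1 ≤ α.parts.length from hk)
      rw [pSum_length] at this
      exact ⟨⟨by omega, by omega, hij⟩, by rw [region_eq hk h1 h2, region_eq hk h3 h4]⟩
  rw [key, Finset.card_biUnion, Finset.sum_range, ← Fin.sum_univ_fun_getElem]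
  · refine Finset.sum_congr rfl fun k _ => ?_
    rw [card_ltPairs, Nat.card_Ioc, pSum_succ α k.2, Nat.add_sub_cancel_left]
  · intro k hk l hl hkl
    rw [Function.onFun, Finset.disjoint_left]
    rintro ⟨i, j⟩ h1 h2
    simp only [mem_ltPairs, Finset.mem_Ioc, Finset.mem_coe, Finset.mem_range] at h1 h2 hk hl
    have e1 := region_eq hk h1.1.1 h1.1.2
    have e2 := region_eq hl h2.1.1 h2.1.2
    omega

theorem allowed_eq : allowed α =
    (((Finset.Ioc (center α) n).image (BInv.neg (n := n)) ∪
      ((ltPairs (Finset.Icc 1 n)).filter (fun p => ¬ region α p.1 = region α p.2)).image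
        (fun p => BInv.pair p.1 p.2)) ∪
      ((ltPairs (Finset.Icc 1 n)).filter (fun p => ¬ p.2 ≤ center α)).image
        (fun p => BInv.mixed p.1 p.2) : Finset (BInv n)) := by
  ext t
  rcases t with i | ⟨i, j⟩ | ⟨i, j⟩
  · have : BInv.neg i ∈ allowed α ↔ center α < i ∧ i ≤ n := Iff.rfl
    simp [this]
  · have : BInv.pair i j ∈ allowed α ↔ 1 ≤ i ∧ i < j ∧ j ≤ n ∧ region α i ≠ region α j := Iff.rfl
    simp only [this, Finset.coe_union, Finset.coe_image, Set.mem_union, Set.mem_image,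
      Finset.mem_coe, Finset.mem_filter, mem_ltPairs, Finset.mem_Icc, reduceCtorEq, and_false,
      exists_false, or_false, false_or, BInv.pair.injEq, Prod.exists]
    constructor
    · rintro ⟨h1, h2, h3, h4⟩
      exact ⟨i, j, ⟨⟨by omega, by omega, h2⟩, h4⟩, rfl, rfl⟩
    · rintro ⟨i, j, ⟨⟨h1, h2, h3⟩, h4⟩, rfl, rfl⟩
      exact ⟨h1.1, h3, h2.2, h4⟩
  · have : BInv.mixed i j ∈ allowed α ↔ 1 ≤ i ∧ i < j ∧ j ≤ n ∧ center α < j := Iff.rfl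
    simp only [this, Finset.coe_union, Finset.coe_image, Set.mem_union, Set.mem_image,
      Finset.mem_coe, Finset.mem_filter, mem_ltPairs, Finset.mem_Icc, reduceCtorEq, and_false,
      exists_false, or_false, false_or, BInv.mixed.injEq, Prod.exists]
    constructor
    · rintro ⟨h1, h2, h3, h4⟩
      exact ⟨i, j, ⟨⟨by omega, by omega, h2⟩, by omega⟩, rfl, rfl⟩
    · rintro ⟨i, j, ⟨⟨h1, h2, h3⟩, h4⟩, rfl, rfl⟩
      exact ⟨h1.1, h3, h2.2, by omega⟩

theorem allowed_finite : (allowed α).Finite := by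
  rw [allowed_eq]
  exact Finset.finite_toSet _

theorem lengthFormula_eq : lengthFormula α =
    n ^ 2 - (α.parts.map (fun a => a * (a - 1) / 2)).sum - (center α + 1) * center α / 2 := by
  unfold lengthFormula center
  split_ifs <;> simp

theorem ncard_allowed : (allowed α).ncard = lengthFormula α := by
  have hc := center_le α
  rw [allowed_eq, Set.ncard_coe_finset, Finset.card_union_of_disjoint,
    Finset.card_union_of_disjoint, Finset.card_image_of_injOn, Finset.card_image_of_injOn,
    Finset.card_image_of_injOn, Nat.card_Ioc, lengthFormula_eq]
  · have h1 := Finset.card_filter_add_card_filter_not (s := ltPairs (Finset.Icc 1 n))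
      (fun p => region α p.1 = region α p.2)
    have h2 := Finset.card_filter_add_card_filter_not (s := ltPairs (Finset.Icc 1 n))
      (fun p => p.2 ≤ center α)
    have h3 : (ltPairs (Finset.Icc 1 n)).filter (fun p => p.2 ≤ center α) =
        ltPairs (Finset.Icc 1 (center α)) := by
      ext p
      simp only [Finset.mem_filter, mem_ltPairs, Finset.mem_Icc]
      omega
    have tri : ∀ k : ℕ, k * (k - 1) / 2 * 2 + k = k ^ 2 := by
      intro k
      rw [Nat.div_mul_cancel (Nat.even_mul_pred_self k).two_dvd]
      cases k
      · rfl
      · simp only [Nat.add_sub_cancel]; ring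
    rw [card_sameRegion] at h1
    rw [h3, card_ltPairs, card_ltPairs] at h2
    rw [card_ltPairs] at h1
    simp only [Nat.card_Icc, Nat.add_sub_cancel] at h1 h2
    have tn := tri n
    have tc := tri (center α)
    have e : (center α + 1) * center α = center α ^ 2 + center α := by ring
    rw [e]
    omega
  · intro p _ q _ h
    simpa [Prod.ext_iff] using h
  · intro p _ q _ h
    simpa [Prod.ext_iff] using h
  · intro p _ q _ h
    simpa using h
  · rw [Finset.disjoint_left]
    intro t ht
    simp only [Finset.mem_image] at ht ⊢
    obtain ⟨_, _, rfl⟩ := ht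
    simp
  · rw [Finset.disjoint_left]
    intro t ht
    simp only [Finset.mem_union, Finset.mem_image] at ht ⊢
    rcases ht with ⟨_, _, rfl⟩ | ⟨_, _, rfl⟩ <;> simp

end Counting

section Chains

variable {n : ℕ}

theorem card_le_of_chain {α : BComp n} {m : ℕ} {f : Fin (m + 1) → SignedPerm n}
    (hf : ∀ i, f i ∈ Tset α) (hlt : ∀ i j, i < j → Inv (f i) ⊂ Inv (f j)) :
    m ≤ (allowed α).ncard := by
  have hsub : ∀ i, Inv (f i) ⊆ allowed α := fun i => Inv_subset_allowed (hf i).1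
  have hfin : ∀ i, (Inv (f i)).Finite := fun i => (allowed_finite α).subset (hsub i)
  have key : ∀ k (hk : k < m + 1), k ≤ (Inv (f ⟨k, hk⟩)).ncard := by
    intro k
    induction k with
    | zero => exact fun _ => Nat.zero_le _
    | succ k ih =>
      intro hk
      have h1 := ih (by omega)
      have h2 := Set.ncard_lt_ncard (hlt ⟨k, by omega⟩ ⟨k + 1, hk⟩ (by simp)) (hfin _)
      omega
  exact (key m (by omega)).trans (Set.ncard_le_ncard (hsub _) (allowed_finite α))

/-- The elements of the maximal chain constructed below. -/
def OnChain (α : BComp n) (π : SignedPerm n) : Prop :=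
  (∃ a, LiftPhase (center α) π a) ∨ ∃ a, SinkPhase (center α) (regionZ α) π a

variable {α : BComp n} {π : SignedPerm n}

theorem OnChain.mem_Tset (h : OnChain α π) : π ∈ Tset α := by
  rcases h with ⟨a, h⟩ | ⟨a, h⟩
  · exact h.mem231
  · exact h.mem231

theorem SinkPhase.exists_addsOne (a : ℤ) (h : SinkPhase (center α) (regionZ α) π a)
    (hne : Inv π ≠ allowed α) : ∃ σ, OnChain α σ ∧ AddsOne π σ := by
  by_cases ha : a ≤ n
  · rcases h.step (center_le α) ha (fun x y z _ => regionZ_eq_of_between) with ⟨σ, h1, h2⟩ | h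
    · exact ⟨σ, Or.inr ⟨a, h1⟩, h2⟩
    · exact h.exists_addsOne (a + 1) hne
  · obtain rfl : a = n + 1 := by have := h.le; omega
    exact absurd (subset_antisymm (Inv_subset_allowed h.mem231.1) h.allowed_subset) hne
termination_by (n + 1 - a).toNat

theorem LiftPhase.exists_addsOne (a : ℤ) (h : LiftPhase (center α) π a)
    (hne : Inv π ≠ allowed α) : ∃ σ, OnChain α σ ∧ AddsOne π σ := by
  by_cases ha : a ≤ n
  · rcases h.step (center_le α) ha with ⟨σ, h1, h2⟩ | h
    · exact ⟨σ, Or.inl ⟨a, h1⟩, h2⟩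
    · exact h.exists_addsOne (a + 1) hne
  · obtain rfl : a = n + 1 := by have := h.le; omega
    exact (h.toSinkPhase (ρ := regionZ α) (center_le α)).exists_addsOne _ hne
termination_by (n + 1 - a).toNat

theorem OnChain.exists_addsOne (h : OnChain α π) (hne : Inv π ≠ allowed α) :
    ∃ σ, OnChain α σ ∧ AddsOne π σ := by
  rcases h with ⟨a, h⟩ | ⟨a, h⟩
  · exact h.exists_addsOne a hne
  · exact h.exists_addsOne a hne

theorem onChain_id (α : BComp n) : OnChain α (SignedPerm.id n) := by
  have hc := center_le α
  refine Or.inl ⟨center α + 1, by omega, by omega, ?_, ?_, ?_, ?_, ?_⟩ <;>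
    simp only [SignedPerm.id, Equiv.refl_apply] <;> omega

theorem Inv_id : Inv (SignedPerm.id n) = ∅ := by
  rw [Set.eq_empty_iff_forall_notMem]
  rintro (i | ⟨i, j⟩ | ⟨i, j⟩)
  · rw [neg_mem_Inv]; simp only [SignedPerm.id, Equiv.refl_apply]; omega
  · rw [pair_mem_Inv]; simp only [SignedPerm.id, Equiv.refl_apply]; omega
  · rw [mixed_mem_Inv]; simp only [SignedPerm.id, Equiv.refl_apply]; omega

theorem exists_chain (α : BComp n) : (allowed α).ncard ∈ chainLengths (Tset α) := by
  have hstep : ∀ π : SignedPerm n, ∃ σ, OnChain α π → Inv π ≠ allowed α →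
      OnChain α σ ∧ AddsOne π σ := by
    intro π
    by_cases h : OnChain α π ∧ Inv π ≠ allowed α
    · obtain ⟨σ, hσ⟩ := h.1.exists_addsOne h.2
      exact ⟨σ, fun _ _ => hσ⟩
    · exact ⟨π, fun h1 h2 => absurd ⟨h1, h2⟩ h⟩
  choose g hg using hstep
  have hfin : ∀ π : SignedPerm n, OnChain α π → (Inv π).Finite := fun π h =>
    (allowed_finite α).subset (Inv_subset_allowed h.mem_Tset.1)
  have hmem : ∀ k ≤ (allowed α).ncard, OnChain α (g^[k] (SignedPerm.id n)) ∧
      (Inv (g^[k] (SignedPerm.id n))).ncard = k := by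
    intro k
    induction k with
    | zero => exact fun _ => ⟨onChain_id α, by simp [Inv_id]⟩
    | succ k ih =>
      intro hk
      obtain ⟨h1, h2⟩ := ih (by omega)
      obtain ⟨h3, t, ht, he⟩ := hg _ h1 (fun he => by rw [he] at h2; omega)
      rw [Function.iterate_succ_apply']
      exact ⟨h3, by rw [he, Set.ncard_insert_of_notMem ht (hfin _ h1), h2]⟩
  have hsub : ∀ l k, k ≤ l → l ≤ (allowed α).ncard →
      Inv (g^[k] (SignedPerm.id n)) ⊆ Inv (g^[l] (SignedPerm.id n)) := by
    intro l k hkl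
    induction l, hkl using Nat.le_induction with
    | base => exact fun _ => subset_rfl
    | succ l _ ih =>
      intro hl
      obtain ⟨h1, h2⟩ := hmem l (by omega)
      obtain ⟨-, t, ht, he⟩ := hg _ h1 (fun he => by rw [he] at h2; omega)
      rw [Function.iterate_succ_apply', he]
      exact (ih (by omega)).trans (Set.subset_insert _ _)
  refine ⟨fun i => g^[i] (SignedPerm.id n), fun i => (hmem i (by omega)).1.mem_Tset,
    fun i j hij => (hsub j i (by omega) (by omega)).ssubset_of_ne fun he => ?_⟩
  have h1 := (hmem i (by omega)).2
  have h2 := (hmem j (by omega)).2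
  rw [he] at h1
  omega

end Chains

/-- For every type-B composition `α = (α₁,…,α_r)` of `n`, the
length of `Tam_B(α)` (the maximal `m` admitting a strict chain
`x₀ < ⋯ < x_m` in `H_α(231)`) equals
`n² − Σᵢ αᵢ(αᵢ−1)/2 − (α₁+1)α₁/2` if `α` is join, and
`n² − Σᵢ αᵢ(αᵢ−1)/2` if `α` is split. -/
theorem tamB_length (n : ℕ) (hn : 1 ≤ n) (α : BComp n) :
    IsGreatest (chainLengths (Tset α)) (lengthFormula α) := by
  rw [← ncard_allowed]
  refine ⟨exists_chain α, ?_⟩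
  rintro m ⟨f, hf, hlt⟩
  exact card_le_of_chain hf hlt

end TypeB
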